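/- arXiv:2505.19303 — 2 statements merged into one kernel-verified Lean document; each statement's English description precedes it below -/
import Mathlib

section
/- Let H be a separable complex Hilbert space, let A be a bounded linear operator on H, and suppose ξ, η ∈ H are such that both (Aⁿξ)_{n≥0} and (Aⁿη)_{n≥0} are frames for H. Then there exists a bounded invertible operator T on H with TA = AT and Tξ = η; that is, every frame representation of the monoid ℤ₊ = {0, 1, 2, …} is central. -/
noncomputable section

open scoped ENNReal

local notation "⟪" x ", " y "⟫" => @inner ℂ _ _ x y

/-- The Hilbert space `ℓ²(S)` of square-summable complex functions on `S`. -/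
abbrev l2 (S : Type*) : Type _ := lp (fun _ : S => ℂ) 2

/-- The standard orthonormal basis vector `δ_t ∈ ℓ²(S)`. -/
def sdelta {S : Type*} [DecidableEq S] (t : S) : l2 S := lp.single 2 t 1

/-- The family `(f s)_{s ∈ S}` is a frame for `H`. -/
def IsFrame {S H : Type*} [NormedAddCommGroup H] [InnerProductSpace ℂ H] (f : S → H) : Prop :=
  ∃ C₁ C₂ : ℝ, 0 < C₁ ∧ C₁ ≤ C₂ ∧ ∀ x : H,
    (C₁ * ‖x‖ ^ 2 ≤ ∑' s, ‖⟪x, f s⟫‖ ^ 2) ∧ (∑' s, ‖⟪x, f s⟫‖ ^ 2 ≤ C₂ * ‖x‖ ^ 2)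

/-- The family `(f s)_{s ∈ S}` is a Bessel sequence in `H`. -/
def IsBessel {S H : Type*} [NormedAddCommGroup H] [InnerProductSpace ℂ H] (f : S → H) : Prop :=
  ∃ C₂ : ℝ, 0 < C₂ ∧ ∀ x : H, ∑' s, ‖⟪x, f s⟫‖ ^ 2 ≤ C₂ * ‖x‖ ^ 2

/-- `π` is a representation of the monoid `S` on `H`: `π 1 = 1` and `π (s*t) = π s ∘ π t`. -/
def IsRepn {S H : Type*} [Monoid S] [NormedAddCommGroup H] [InnerProductSpace ℂ H]
    (π : S → (H →L[ℂ] H)) : Prop :=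
  π 1 = 1 ∧ ∀ s t : S, π (s * t) = π s * π t

/-- `Θ` is the analysis operator of the family `(π s ξ)_{s ∈ S}`:
`Θ x = (⟨x, π s ξ⟩)_{s ∈ S}`. -/
def IsAnalysisOp {S H : Type*} [NormedAddCommGroup H] [InnerProductSpace ℂ H]
    (π : S → (H →L[ℂ] H)) (ξ : H) (Θ : H →L[ℂ] l2 S) : Prop :=
  ∀ (x : H) (s : S), Θ x s = ⟪x, π s ξ⟫

/-- `lam` is the left regular representation of `S` on `ℓ²(S)`: `lam s δ_t = δ_{s*t}`. -/
def IsLeftRegularRepn {S : Type*} [Monoid S] [DecidableEq S]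
    (lam : S → (l2 S →L[ℂ] l2 S)) : Prop :=
  ∀ s t : S, lam s (sdelta t) = sdelta (s * t)

/-- The subspace `M` is co-invariant under `lam`: `Mᗮ` is invariant under every `lam s`. -/
def IsCoinvariant {S : Type*} (lam : S → (l2 S →L[ℂ] l2 S)) (M : Submodule ℂ (l2 S)) : Prop :=
  ∀ s : S, ∀ y ∈ Mᗮ, lam s y ∈ Mᗮ

/-- `M` is co-hyperinvariant under `lam`: `Mᗮ` is invariant under every `lam s` and, in addition,
under every bounded operator commuting with all the `lam s`. -/
def IsCoHyperinvariant {S : Type*} (lam : S → (l2 S →L[ℂ] l2 S))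
    (M : Submodule ℂ (l2 S)) : Prop :=
  IsCoinvariant lam M ∧
    ∀ B : l2 S →L[ℂ] l2 S, (∀ s : S, B * lam s = lam s * B) → ∀ y ∈ Mᗮ, B y ∈ Mᗮ

/-- The representation `π` is central: any two frame vectors are equivalent, i.e. there is a
bounded invertible operator commuting with the representation carrying one to the other. -/
def IsCentral {S H : Type*} [NormedAddCommGroup H] [InnerProductSpace ℂ H]
    (π : S → (H →L[ℂ] H)) : Prop :=
  ∀ ξ η : H, IsFrame (fun s => π s ξ) → IsFrame (fun s => π s η) →
    ∃ T : H ≃L[ℂ] H, (∀ (s : S) (x : H), T (π s x) = π s (T x)) ∧ T ξ = η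

lemma l2_single_eq (n : ℕ) (a : ℂ) : (lp.single 2 n a : l2 ℕ) = a • sdelta n := by
  rw [sdelta, ← lp.single_smul, smul_eq_mul, mul_one]

lemma hasSum_sdelta (x : l2 ℕ) : HasSum (fun n => x n • sdelta n) x := by
  simpa only [l2_single_eq] using lp.hasSum_single (p := 2) (by simp) x

lemma inner_sdelta_left (n : ℕ) (x : l2 ℕ) : ⟪sdelta n, x⟫ = x n := by
  rw [sdelta, lp.inner_single_left]
  simp

lemma orthonormal_sdelta : Orthonormal ℂ (sdelta : ℕ → l2 ℕ) := by
  rw [orthonormal_iff_ite]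
  intro i j
  rw [inner_sdelta_left, sdelta, lp.single_apply, Pi.single_apply]

/-- A continuous semilinear map on `ℓ²(ℕ)` vanishing on the standard basis is zero. -/
lemma eq_zero_of_sdelta {σ : ℂ →+* ℂ} {E : Type*} [NormedAddCommGroup E] [NormedSpace ℂ E]
    (f : l2 ℕ →SL[σ] E) (h : ∀ n, f (sdelta n) = 0) (x : l2 ℕ) : f x = 0 := by
  have h₁ := (hasSum_sdelta x).map f f.continuous
  have h₂ : (f ∘ fun n => x n • (sdelta n : l2 ℕ)) = fun _ => 0 := by
    funext n
    simp [h]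
  rw [h₂] at h₁
  exact h₁.unique hasSum_zero

lemma ext_sdelta {E : Type*} [NormedAddCommGroup E] [NormedSpace ℂ E]
    (f g : l2 ℕ →L[ℂ] E) (h : ∀ n, f (sdelta n) = g (sdelta n)) : f = g := by
  ext1 x
  exact sub_eq_zero.1 (eq_zero_of_sdelta (f - g) (fun n => by simp [h]) x)

/-- A bounded sesquilinear form on `ℓ²(ℕ)` vanishing on the standard basis is zero. -/
lemma sesq_eq_zero_of_sdelta (F : l2 ℕ →ₗ⋆[ℂ] l2 ℕ →ₗ[ℂ] ℂ) (C : ℝ)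
    (hC : ∀ b c, ‖F b c‖ ≤ C * ‖b‖ * ‖c‖) (h : ∀ m k, F (sdelta m) (sdelta k) = 0)
    (b c : l2 ℕ) : F b c = 0 := by
  have h₁ : ∀ m, F (sdelta m) c = 0 := fun m =>
    eq_zero_of_sdelta ((F (sdelta m)).mkContinuous (C * ‖(sdelta m : l2 ℕ)‖) (hC _)) (h m) c
  exact eq_zero_of_sdelta ((F.flip c).mkContinuous (C * ‖c‖) fun b => by
    rw [mul_right_comm]; exact hC b c) h₁ b

/-- The isometry of `ℓ²(ℕ)` sending the standard basis to a given orthonormal sequence. -/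
def basisIsometry {v : ℕ → l2 ℕ} (hv : Orthonormal ℂ v) : l2 ℕ →ₗᵢ[ℂ] l2 ℕ :=
  hv.orthogonalFamily.linearIsometry

lemma basisIsometry_sdelta {v : ℕ → l2 ℕ} (hv : Orthonormal ℂ v) (n : ℕ) :
    basisIsometry hv (sdelta n) = v n := by
  rw [basisIsometry, sdelta, OrthogonalFamily.linearIsometry_apply_single]
  simp

lemma orthonormal_sdelta_succ : Orthonormal ℂ (fun n : ℕ => (sdelta (n + 1) : l2 ℕ)) :=
  orthonormal_sdelta.comp _ (add_left_injective 1)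

/-- The unilateral shift on `ℓ²(ℕ)`. -/
def shift : l2 ℕ →ₗᵢ[ℂ] l2 ℕ := basisIsometry orthonormal_sdelta_succ

lemma shift_sdelta (n : ℕ) : shift (sdelta n) = sdelta (n + 1) :=
  basisIsometry_sdelta orthonormal_sdelta_succ n

lemma shift_pow_succ_apply (n : ℕ) (x : l2 ℕ) : (shift ^ (n + 1)) x = shift ((shift ^ n) x) := by
  rw [pow_succ']
  rfl

lemma shift_pow_sdelta (n k : ℕ) : (shift ^ n) (sdelta k) = sdelta (k + n) := by
  induction n with
  | zero => simp
  | succ n ih => rw [shift_pow_succ_apply, ih, shift_sdelta, add_assoc]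

lemma shift_apply_zero (x : l2 ℕ) : shift x 0 = 0 := by
  rw [← inner_sdelta_left]
  exact eq_zero_of_sdelta ((innerSL ℂ (sdelta 0)).comp shift.toContinuousLinearMap)
    (fun n => by
      change ⟪(sdelta 0 : l2 ℕ), shift (sdelta n)⟫ = 0
      rw [shift_sdelta]
      exact orthonormal_sdelta.2 (by simp)) x

lemma shift_apply_succ (x : l2 ℕ) (n : ℕ) : shift x (n + 1) = x n := by
  rw [← inner_sdelta_left, ← shift_sdelta, LinearIsometry.inner_map_map, inner_sdelta_left]

lemma orthonormal_rotation (x : UnitAddCircle) :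
    Orthonormal ℂ (fun n : ℕ => fourier (-(n : ℤ)) x • (sdelta n : l2 ℕ)) := by
  refine ⟨fun n => ?_, fun m n hmn => ?_⟩
  · rw [norm_smul, orthonormal_sdelta.1 n, mul_one, fourier_apply, Circle.norm_coe]
  · simp only [inner_smul_left, inner_smul_right, orthonormal_sdelta.2 hmn, mul_zero]

/-- The diagonal unitary on `ℓ²(ℕ)` multiplying the `n`-th basis vector by the character `-n`. -/
def l2Rotation (x : UnitAddCircle) : l2 ℕ →ₗᵢ[ℂ] l2 ℕ := basisIsometry (orthonormal_rotation x)

lemma rotation_sdelta (x : UnitAddCircle) (n : ℕ) :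
    l2Rotation x (sdelta n) = fourier (-(n : ℤ)) x • sdelta n :=
  basisIsometry_sdelta (orthonormal_rotation x) n

lemma rotation_zero_apply (c : l2 ℕ) : l2Rotation 0 c = c := by
  have : (l2Rotation 0).toContinuousLinearMap = ContinuousLinearMap.id ℂ (l2 ℕ) :=
    ext_sdelta _ _ fun n => by
      change l2Rotation 0 (sdelta n) = sdelta n
      rw [rotation_sdelta, fourier_eval_zero, one_smul]
  exact congrArg (fun f => f c) this

lemma continuous_rotation (c : l2 ℕ) : Continuous fun x => l2Rotation x c := by
  refine continuous_of_uniform_approx_of_continuous fun u hu => ?_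
  obtain ⟨ε, hε, hεu⟩ := Metric.mem_uniformity_dist.1 hu
  obtain ⟨s, hs⟩ := ((Metric.tendsto_nhds.1 (hasSum_sdelta c)) ε hε).exists
  refine ⟨fun x => l2Rotation x (∑ n ∈ s, c n • sdelta n), ?_, fun x => hεu ?_⟩
  · simp only [map_sum, map_smul, rotation_sdelta]
    fun_prop
  · rw [LinearIsometry.dist_map, dist_comm]
    exact hs

open MeasureTheory AddCircle in
lemma fourierCoeff_rotation_eq (M N : l2 ℕ →L[ℂ] l2 ℕ) (i : ℤ)
    (h : ∀ m k : ℕ, ⟪sdelta m, N (sdelta k)⟫ =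
      if i = (m : ℤ) - k then ⟪sdelta m, M (sdelta k)⟫ else 0) (b c : l2 ℕ) :
    fourierCoeff (fun x : UnitAddCircle => ⟪l2Rotation x b, M (l2Rotation x c)⟫) i = ⟪b, N c⟫ := by
  have hcont : ∀ b c : l2 ℕ, Continuous fun x : UnitAddCircle =>
      ⟪l2Rotation x b, M (l2Rotation x c)⟫ := fun b c =>
    (continuous_rotation b).inner (M.continuous.comp (continuous_rotation c))
  have hint : ∀ b c : l2 ℕ, Integrable (fun x : UnitAddCircle =>
      fourier (-i) x • ⟪l2Rotation x b, M (l2Rotation x c)⟫) haarAddCircle := fun b c =>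
    (((fourier (-i)).continuous.smul (hcont b c)).integrable_of_hasCompactSupport
      (HasCompactSupport.of_compactSpace _))
  let F : l2 ℕ →ₗ⋆[ℂ] l2 ℕ →ₗ[ℂ] ℂ := LinearMap.mk₂'ₛₗ _ _
    (fun b c => fourierCoeff (fun x : UnitAddCircle => ⟪l2Rotation x b, M (l2Rotation x c)⟫) i
      - ⟪b, N c⟫)
    (fun b b' c => by
      simp only [fourierCoeff, map_add, inner_add_left, smul_add]
      rw [integral_add (hint b c) (hint b' c)]
      ring)
    (fun a b c => by
      simp only [fourierCoeff, map_smul, inner_smul_left, smul_eq_mul,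
        mul_left_comm _ (starRingEnd ℂ a)]
      rw [integral_const_mul]
      ring)
    (fun b c c' => by
      simp only [fourierCoeff, map_add, inner_add_right, smul_add]
      rw [integral_add (hint b c) (hint b c')]
      ring)
    (fun a b c => by
      simp only [fourierCoeff, map_smul, inner_smul_right, smul_eq_mul, mul_left_comm _ a,
        RingHom.id_apply]
      rw [integral_const_mul]
      ring)
  have hF : F b c = 0 := by
    refine sesq_eq_zero_of_sdelta F (‖M‖ + ‖N‖) (fun b c => ?_) (fun m k => ?_) b c
    · change ‖fourierCoeff (fun x : UnitAddCircle => ⟪l2Rotation x b, M (l2Rotation x c)⟫) i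
        - ⟪b, N c⟫‖ ≤ _
      have h₁ : ‖fourierCoeff (fun x : UnitAddCircle => ⟪l2Rotation x b, M (l2Rotation x c)⟫) i‖
          ≤ ‖b‖ * (‖M‖ * ‖c‖) := by
        have := norm_integral_le_of_norm_le_const (μ := haarAddCircle (T := 1))
          (f := fun x : UnitAddCircle => fourier (-i) x • ⟪l2Rotation x b, M (l2Rotation x c)⟫)
          (C := ‖b‖ * (‖M‖ * ‖c‖)) (Filter.Eventually.of_forall fun x => by
            rw [norm_smul, fourier_apply, Circle.norm_coe, one_mul]
            refine (norm_inner_le_norm _ _).trans ?_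
            rw [LinearIsometry.norm_map]
            gcongr
            simpa using M.le_opNorm (l2Rotation x c))
        simpa [fourierCoeff] using this
      have h₂ : ‖⟪b, N c⟫‖ ≤ ‖b‖ * (‖N‖ * ‖c‖) :=
        (norm_inner_le_norm _ _).trans (by gcongr; exact N.le_opNorm c)
      refine (norm_sub_le _ _).trans ((add_le_add h₁ h₂).trans (le_of_eq ?_))
      ring
    · change fourierCoeff (fun x : UnitAddCircle =>
        ⟪l2Rotation x (sdelta m), M (l2Rotation x (sdelta k))⟫) i - ⟪sdelta m, N (sdelta k)⟫ = 0
      have h₁ : (fun x : UnitAddCircle => ⟪l2Rotation x (sdelta m), M (l2Rotation x (sdelta k))⟫) =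
          fun x => ⟪sdelta m, M (sdelta k)⟫ * fourier ((m : ℤ) - k) x := by
        funext x
        rw [rotation_sdelta, rotation_sdelta, map_smul, inner_smul_left, inner_smul_right,
          ← fourier_neg, neg_neg, sub_eq_add_neg, fourier_add]
        ring
      rw [h₁, fourierCoeff.const_mul, fourierCoeff_fourier, h, Pi.single_apply]
      split_ifs <;> simp
  exact sub_eq_zero.1 hF

/-- If `φ` generates an orthonormal orbit under the shift, convolution by `φ` is given weakly by
the power series `∑ φ n • shift ^ n`, wherever the latter converges absolutely. -/
lemma hasSum_inner_basisIsometry (φ : l2 ℕ) (hφ : Orthonormal ℂ fun n : ℕ => (shift ^ n) φ)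
    (b c : l2 ℕ) (hs : Summable fun n : ℕ => φ n * ⟪b, (shift ^ n) c⟫) :
    HasSum (fun n : ℕ => φ n * ⟪b, (shift ^ n) c⟫) ⟪b, basisIsometry hφ c⟫ := by
  set M := (basisIsometry hφ).toContinuousLinearMap
  have hMk : ∀ m k : ℕ, ⟪sdelta m, M (sdelta k)⟫ = if k ≤ m then φ (m - k) else 0 := by
    intro m k
    change ⟪(sdelta m : l2 ℕ), basisIsometry hφ (sdelta k)⟫ = _
    rw [basisIsometry_sdelta, inner_sdelta_left]
    clear hs M hφ
    induction k generalizing m with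
    | zero => simp
    | succ k ih =>
      rw [shift_pow_succ_apply]
      cases m with
      | zero => simp [shift_apply_zero]
      | succ m => simp [shift_apply_succ, ih]
  have hpos : ∀ n : ℕ, fourierCoeff (fun x : UnitAddCircle => ⟪l2Rotation x b, M (l2Rotation x c)⟫) n
      = φ n * ⟪b, (shift ^ n) c⟫ := by
    intro n
    rw [fourierCoeff_rotation_eq M (φ n • (shift ^ n).toContinuousLinearMap) n]
    · simp
    · intro m k
      rw [hMk]
      change ⟪(sdelta m : l2 ℕ), φ n • (shift ^ n) (sdelta k)⟫ = _
      rw [inner_smul_right, shift_pow_sdelta, orthonormal_iff_ite.1 orthonormal_sdelta]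
      by_cases hmn : m = k + n
      · subst hmn; simp
      · rw [if_neg hmn, if_neg (by omega), mul_zero]
  have hneg : ∀ n : ℕ,
      fourierCoeff (fun x : UnitAddCircle => ⟪l2Rotation x b, M (l2Rotation x c)⟫) (-(n + 1 : ℕ))
      = 0 := by
    intro n
    rw [fourierCoeff_rotation_eq M 0 _]
    · simp
    · intro m k
      rw [hMk]
      split_ifs
      · omega
      all_goals simp
  let f : C(UnitAddCircle, ℂ) := ⟨fun x => ⟪l2Rotation x b, M (l2Rotation x c)⟫,
    (continuous_rotation b).inner (M.continuous.comp (continuous_rotation c))⟩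
  have hinj : Function.Injective (Nat.cast : ℕ → ℤ) := Nat.cast_injective
  have hsupp : ∀ i : ℤ, i ∉ Set.range (Nat.cast : ℕ → ℤ) → fourierCoeff f i = 0 := by
    intro i hi
    have hi' : i < 0 := by
      by_contra hge
      exact hi ⟨i.toNat, by omega⟩
    have := hneg (-i - 1).toNat
    rwa [show (-(((-i - 1).toNat + 1 : ℕ) : ℤ)) = i by omega] at this
  have hsum : Summable (fourierCoeff f) :=
    (hinj.summable_iff hsupp).1 (hs.congr fun n => (hpos n).symm)
  have h₀ := has_pointwise_sum_fourier_series_of_summable hsum 0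
  have hf₀ : f 0 = ⟪b, basisIsometry hφ c⟫ := by
    change ⟪l2Rotation 0 b, M (l2Rotation 0 c)⟫ = _
    rw [rotation_zero_apply, rotation_zero_apply]
    rfl
  simp only [fourier_eval_zero, smul_eq_mul, mul_one, hf₀] at h₀
  rw [← hinj.hasSum_iff hsupp] at h₀
  exact h₀.congr_fun fun n => (hpos n).symm

section Frame

variable {H : Type*} [NormedAddCommGroup H] [InnerProductSpace ℂ H]

lemma map_shift_pow {A : H →L[ℂ] H} {θ : l2 ℕ →L[ℂ] H} (hθ : ∀ x, θ (shift x) = A (θ x))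
    (n : ℕ) (x : l2 ℕ) : θ ((shift ^ n) x) = (A ^ n) (θ x) := by
  induction n with
  | zero => simp
  | succ n ih => rw [shift_pow_succ_apply, pow_succ', hθ, ih,
      mul_apply_eq_comp]

/-- If `θ` and `θ'` intertwine the shift with `A` and `θ` is surjective, every element of `ker θ`
with orthonormal shift orbit is also annihilated by the other operator. -/
lemma map_eq_zero_of_orthonormal [CompleteSpace H] {A : H →L[ℂ] H} {θ θ' : l2 ℕ →L[ℂ] H}
    (hθ : ∀ x, θ (shift x) = A (θ x)) (hθ' : ∀ x, θ' (shift x) = A (θ' x))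
    (hsurj : Function.Surjective θ) {φ : l2 ℕ} (hφ : Orthonormal ℂ fun n : ℕ => (shift ^ n) φ)
    (h₀ : θ φ = 0) : θ' φ = 0 := by
  obtain ⟨c, hc⟩ := hsurj (θ' (sdelta 0))
  have hM : ∀ x, θ (basisIsometry hφ x) = 0 :=
    eq_zero_of_sdelta (θ.comp (basisIsometry hφ).toContinuousLinearMap) fun n => by
      change θ (basisIsometry hφ (sdelta n)) = 0
      rw [basisIsometry_sdelta, map_shift_pow hθ, h₀, map_zero]
  refine ext_inner_left ℂ fun y => ?_
  have h₁ : ∀ n, φ n * ⟪θ.adjoint y, (shift ^ n) c⟫ = ⟪y, θ' (φ n • sdelta n)⟫ := by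
    intro n
    rw [ContinuousLinearMap.adjoint_inner_left, map_shift_pow hθ, hc, ← map_shift_pow hθ',
      shift_pow_sdelta, zero_add, map_smul, inner_smul_right]
  have h₂ : HasSum (fun n => ⟪y, θ' (φ n • sdelta n)⟫) ⟪y, θ' φ⟫ :=
    (hasSum_sdelta φ).mapL ((innerSL ℂ y).comp θ')
  have h₃ := hasSum_inner_basisIsometry φ hφ (θ.adjoint y) c (h₂.summable.congr fun n => (h₁ n).symm)
  rw [ContinuousLinearMap.adjoint_inner_left, hM] at h₃
  simp only [h₁] at h₃
  exact h₂.unique h₃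

/-- Orthogonality of `φ` to the shifted invariant subspace makes its shift orbit orthonormal. -/
lemma orthonormal_shift_pow {K : Submodule ℂ (l2 ℕ)} (hK : ∀ x ∈ K, shift x ∈ K) {φ : l2 ℕ}
    (hφK : φ ∈ K) (hφ : ∀ x ∈ K, ⟪shift x, φ⟫ = 0) (h₁ : ‖φ‖ = 1) :
    Orthonormal ℂ fun n : ℕ => (shift ^ n) φ := by
  have hmem : ∀ n : ℕ, (shift ^ n) φ ∈ K := by
    intro n
    induction n with
    | zero => simpa using hφK
    | succ n ih => rw [shift_pow_succ_apply]; exact hK _ ih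
  have hlt : ∀ m d : ℕ, ⟪(shift ^ (m + (d + 1))) φ, (shift ^ m) φ⟫ = 0 := by
    intro m d
    rw [pow_add]
    change ⟪(shift ^ m) ((shift ^ (d + 1)) φ), (shift ^ m) φ⟫ = 0
    rw [LinearIsometry.inner_map_map, shift_pow_succ_apply, hφ _ (hmem d)]
  refine ⟨fun n => by rw [LinearIsometry.norm_map, h₁], fun m n hmn => ?_⟩
  rcases lt_or_gt_of_ne hmn with h | h
  · obtain ⟨d, rfl⟩ := Nat.exists_eq_add_of_lt h
    rw [inner_eq_zero_symm]
    exact hlt m d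
  · obtain ⟨d, rfl⟩ := Nat.exists_eq_add_of_lt h
    exact hlt n d

/-- Wold decomposition: a closed shift-invariant subspace is contained in any closed
shift-invariant subspace containing its wandering vectors. -/
lemma le_of_wandering {K L : Submodule ℂ (l2 ℕ)} (hKc : IsClosed (K : Set (l2 ℕ)))
    (hLc : IsClosed (L : Set (l2 ℕ))) (hK : ∀ x ∈ K, shift x ∈ K) (hL : ∀ x ∈ L, shift x ∈ L)
    (h : ∀ φ ∈ K, (∀ x ∈ K, ⟪shift x, φ⟫ = 0) → φ ∈ L) : K ≤ L := by
  have hzero : ∀ m : ℕ, ∀ q ∈ K, (∀ n : ℕ, ∀ φ ∈ K, (∀ x ∈ K, ⟪shift x, φ⟫ = 0) →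
      ⟪(shift ^ n) φ, q⟫ = 0) → q m = 0 := by
    have hstep : ∀ q ∈ K, (∀ n : ℕ, ∀ φ ∈ K, (∀ x ∈ K, ⟪shift x, φ⟫ = 0) →
        ⟪(shift ^ n) φ, q⟫ = 0) → ∃ s ∈ K, shift s = q := by
      intro q hq hq'
      have : CompleteSpace (K.map shift.toLinearMap) :=
        (shift.isometry.isClosedEmbedding.isClosedMap _ hKc).completeSpace_coe
      obtain ⟨y, hy, z, hz, rfl⟩ :=
        (K.map shift.toLinearMap).exists_add_mem_mem_orthogonal q
      obtain ⟨s, hs, rfl⟩ := hy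
      have hzK : z ∈ K := by
        have := K.sub_mem hq (hK s hs)
        rwa [show shift.toLinearMap s + z - shift s = z from add_sub_cancel_left _ _] at this
      have hzort : ∀ x ∈ K, ⟪shift x, z⟫ = 0 := fun x hx =>
        (Submodule.mem_orthogonal _ _).1 hz _ ⟨x, hx, rfl⟩
      have h₁ : ⟪z, shift s + z⟫ = 0 := by simpa using hq' 0 z hzK hzort
      rw [inner_add_right, inner_eq_zero_symm.1 (hzort s hs), zero_add,
        inner_self_eq_zero] at h₁
      exact ⟨s, hs, by rw [h₁, add_zero]; rfl⟩
    intro m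
    induction m with
    | zero =>
      intro q hq hq'
      obtain ⟨s, -, rfl⟩ := hstep q hq hq'
      exact shift_apply_zero s
    | succ m ih =>
      intro q hq hq'
      obtain ⟨s, hs, rfl⟩ := hstep q hq hq'
      rw [shift_apply_succ]
      refine ih s hs fun n φ hφ hφ' => ?_
      rw [← LinearIsometry.inner_map_map shift, ← shift_pow_succ_apply]
      exact hq' (n + 1) φ hφ hφ'
  have hpow : ∀ φ ∈ K ⊓ L, ∀ n : ℕ, (shift ^ n) φ ∈ K ⊓ L := by
    intro φ hφ n
    induction n with
    | zero => simpa using hφ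
    | succ n ih => rw [shift_pow_succ_apply]; exact ⟨hK _ ih.1, hL _ ih.2⟩
  intro x hx
  have : CompleteSpace (K ⊓ L : Submodule ℂ (l2 ℕ)) := (hKc.inter hLc).completeSpace_coe
  obtain ⟨p, hp, q, hq, rfl⟩ := (K ⊓ L).exists_add_mem_mem_orthogonal x
  have hqK : q ∈ K := by simpa using K.sub_mem hx hp.1
  have hq₀ : q = 0 := by
    ext m
    exact hzero m q hqK fun n φ hφ hφ' =>
      (Submodule.mem_orthogonal _ _).1 hq _ (hpow φ ⟨hφ, h φ hφ hφ'⟩ n)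
  rw [hq₀, add_zero]
  exact hp.2

/-- Surjective operators intertwining the shift with the same `A` have comparable kernels. -/
lemma ker_le_ker [CompleteSpace H] {A : H →L[ℂ] H} {θ θ' : l2 ℕ →L[ℂ] H}
    (hθ : ∀ x, θ (shift x) = A (θ x)) (hθ' : ∀ x, θ' (shift x) = A (θ' x))
    (hsurj : Function.Surjective θ) {x : l2 ℕ} (hx : θ x = 0) : θ' x = 0 := by
  refine le_of_wandering (K := θ.ker) (L := θ'.ker) θ.isClosed_ker θ'.isClosed_ker
    (fun x hx => ?_) (fun x hx => ?_) (fun φ hφ hφ' => ?_) hx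
  · change θ (shift x) = 0
    rw [hθ, show θ x = 0 from hx, map_zero]
  · change θ' (shift x) = 0
    rw [hθ', show θ' x = 0 from hx, map_zero]
  · change θ' φ = 0
    by_cases h₀ : φ = 0
    · rw [h₀, map_zero]
    have hn : ((‖φ‖⁻¹ : ℝ) : ℂ) ≠ 0 := by simpa using h₀
    have h₁ := map_eq_zero_of_orthonormal hθ hθ' hsurj
      (φ := ((‖φ‖⁻¹ : ℝ) : ℂ) • φ)
      (orthonormal_shift_pow (K := θ.ker)
        (fun x hx => by
          change θ (shift x) = 0
          rw [hθ, show θ x = 0 from hx, map_zero])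
        (Submodule.smul_mem _ _ hφ)
        (fun x hx => by rw [inner_smul_right, hφ' x hx, mul_zero])
        (by
          rw [norm_smul, Complex.norm_real, norm_inv, norm_norm,
            inv_mul_cancel₀ (norm_ne_zero_iff.2 h₀)]))
      (by rw [map_smul, show θ φ = 0 from hφ, smul_zero])
    rw [map_smul] at h₁
    exact (smul_eq_zero.1 h₁).resolve_left hn

lemma IsFrame.summable {S : Type*} {f : S → H} (hf : IsFrame f) (x : H) :
    Summable fun s => ‖⟪f s, x⟫‖ ^ 2 := by
  obtain ⟨C₁, C₂, hC₁, -, h⟩ := hf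
  simp only [norm_inner_symm _ x]
  by_contra hs
  have h₁ := (h x).1
  rw [tsum_eq_zero_of_not_summable hs] at h₁
  have hx : x = 0 := by
    by_contra hx
    have := mul_pos hC₁ (pow_pos (norm_pos_iff.2 hx) 2)
    linarith
  exact hs (by simp [hx])

/-- The synthesis operator of a frame exists and has a bounded right inverse. -/
lemma IsFrame.exists_synthesis [CompleteSpace H] {f : ℕ → H} (hf : IsFrame f) :
    ∃ θ : l2 ℕ →L[ℂ] H, (∀ n, θ (sdelta n) = f n) ∧
      ∃ R : H →L[ℂ] l2 ℕ, ∀ y, θ (R y) = y := by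
  have hsum := hf.summable
  obtain ⟨C₁, C₂, hC₁, hC, h⟩ := hf
  have hmem : ∀ x : H, Memℓp (fun n => ⟪f n, x⟫) 2 := fun x =>
    memℓp_gen (by simpa using hsum x)
  let Θ₀ : H →ₗ[ℂ] l2 ℕ :=
    { toFun := fun x => ⟨fun n => ⟪f n, x⟫, hmem x⟩
      map_add' := fun x y => by ext n; exact inner_add_right _ _ _
      map_smul' := fun a x => by ext n; exact inner_smul_right _ _ _ }
  have hnorm : ∀ x, ‖Θ₀ x‖ ^ 2 = ∑' n, ‖⟪x, f n⟫‖ ^ 2 := by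
    intro x
    have := lp.norm_rpow_eq_tsum (p := 2) (by simp) (Θ₀ x)
    simp only [norm_inner_symm x]
    simpa [Θ₀] using this
  let Θ : H →L[ℂ] l2 ℕ := Θ₀.mkContinuous (Real.sqrt C₂) fun x => by
    refine le_of_sq_le_sq ?_ (by positivity)
    rw [hnorm, mul_pow, Real.sq_sqrt (hC₁.le.trans hC)]
    exact (h x).2
  have hunit : IsUnit (Θ.adjoint ∘L Θ) := by
    refine ContinuousLinearMap.isUnit_of_forall_le_norm_inner_map _ (c := ⟨C₁, hC₁.le⟩) hC₁
      fun x => ?_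
    rw [ContinuousLinearMap.comp_apply, ContinuousLinearMap.adjoint_inner_left,
      inner_self_eq_norm_sq_to_K, mul_comm]
    refine (h x).1.trans ?_
    rw [← hnorm]
    simp [Θ]
  obtain ⟨u, hu⟩ := hunit
  refine ⟨Θ.adjoint, fun n => ext_inner_right ℂ fun y => ?_, Θ ∘L (↑u⁻¹ : H →L[ℂ] H), fun y => ?_⟩
  · rw [ContinuousLinearMap.adjoint_inner_left, inner_sdelta_left]
    rfl
  · have h₁ : (Θ.adjoint ∘L Θ) * (↑u⁻¹ : H →L[ℂ] H) = 1 := by rw [← hu, Units.mul_inv]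
    exact congrArg (fun g => g y) h₁

end Frame

/-- If `A` is a bounded operator on a separable Hilbert space `H` and both
`(Aⁿξ)_{n ≥ 0}` and `(Aⁿη)_{n ≥ 0}` are frames for `H`, then there is a bounded invertible `T`
commuting with `A` such that `Tξ = η`; i.e. every frame representation of `ℤ₊` is central. -/
theorem statement11 {H : Type*} [NormedAddCommGroup H] [InnerProductSpace ℂ H] [CompleteSpace H]
    [TopologicalSpace.SeparableSpace H] (A : H →L[ℂ] H) (ξ η : H)
    (hξ : IsFrame fun n : ℕ => (A ^ n) ξ) (hη : IsFrame fun n : ℕ => (A ^ n) η) :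
    ∃ T : H ≃L[ℂ] H, (∀ x : H, T (A x) = A (T x)) ∧ T ξ = η := by
  obtain ⟨θ, hθe, R, hR⟩ := hξ.exists_synthesis
  obtain ⟨θ', hθe', R', hR'⟩ := hη.exists_synthesis
  have hint : ∀ (θ : l2 ℕ →L[ℂ] H) (ζ : H), (∀ n, θ (sdelta n) = (A ^ n) ζ) →
      ∀ x, θ (shift x) = A (θ x) := fun θ ζ h x =>
    congrArg (fun g => g x) <| ext_sdelta (θ ∘L shift.toContinuousLinearMap) (A ∘L θ) fun n => by
      change θ (shift (sdelta n)) = A (θ (sdelta n))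
      rw [shift_sdelta, h, h, pow_succ', mul_apply_eq_comp]
  have hθ := hint θ ξ hθe
  have hθ' := hint θ' η hθe'
  have hT : ∀ x, θ' (R (θ x)) = θ' x := fun x => sub_eq_zero.1 <| by
    rw [← map_sub]
    exact ker_le_ker hθ hθ' (fun y => ⟨R y, hR y⟩) (by rw [map_sub, hR, sub_self])
  have hT' : ∀ x, θ (R' (θ' x)) = θ x := fun x => sub_eq_zero.1 <| by
    rw [← map_sub]
    exact ker_le_ker hθ' hθ (fun y => ⟨R' y, hR' y⟩) (by rw [map_sub, hR', sub_self])
  refine ⟨ContinuousLinearEquiv.equivOfInverse (θ' ∘L R) (θ ∘L R')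
    (fun y => (hT' (R y)).trans (hR y)) (fun y => (hT (R' y)).trans (hR' y)),
    fun y => ?_, ?_⟩
  · change θ' (R (A y)) = A (θ' (R y))
    conv_lhs => rw [← hR y, ← hθ, hT, hθ']
  · change θ' (R ξ) = η
    have h₁ := hT (sdelta 0)
    rwa [hθe, hθe', pow_zero, one_apply_eq_self, one_apply_eq_self] at h₁
end
end

section
/- Let S be a countable monoid and let π on H and σ on K be frame representations of S on separable complex Hilbert spaces. Then π and σ are equivalent representations if and only if there exist vectors ξ ∈ H and η ∈ K such that (π(s)ξ)_{s∈S} is a frame for H, (σ(s)η)_{s∈S} is a frame for K, and these two frames are equivalent. -/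
noncomputable section

open scoped ENNReal

local notation "⟪" x ", " y "⟫" => @inner ℂ _ _ x y

theorem IsFrame.eq_zero_of_forall_inner_eq_zero {S H : Type*} [NormedAddCommGroup H]
    [InnerProductSpace ℂ H] {f : S → H} (hf : IsFrame f) {x : H} (hx : ∀ s, ⟪x, f s⟫ = 0) :
    x = 0 := by
  obtain ⟨C₁, C₂, h₁, -, h⟩ := hf
  have hle := (h x).1
  simp only [hx, norm_zero, ne_eq, OfNat.ofNat_ne_zero, not_false_eq_true, zero_pow,
    tsum_zero] at hle
  have hsq : ‖x‖ ^ 2 = 0 := le_antisymm (nonpos_of_mul_nonpos_right hle h₁) (sq_nonneg _)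
  exact norm_eq_zero.mp (pow_eq_zero_iff two_ne_zero |>.mp hsq)

/-- The linear span of a frame is dense. -/
theorem IsFrame.dense_span {S H : Type*} [NormedAddCommGroup H] [InnerProductSpace ℂ H]
    [CompleteSpace H] {f : S → H} (hf : IsFrame f) :
    Dense (Submodule.span ℂ (Set.range f) : Set H) := by
  rw [Submodule.dense_iff_topologicalClosure_eq_top, Submodule.topologicalClosure_eq_top_iff,
    Submodule.eq_bot_iff]
  intro x hx
  refine hf.eq_zero_of_forall_inner_eq_zero fun s => ?_
  exact (Submodule.mem_orthogonal' _ x).mp hx _ (Submodule.subset_span (Set.mem_range_self s))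

/-- The image of a frame under a bounded invertible operator is a frame. -/
theorem IsFrame.map_equiv {S H K : Type*} [NormedAddCommGroup H] [InnerProductSpace ℂ H]
    [CompleteSpace H] [NormedAddCommGroup K] [InnerProductSpace ℂ K] [CompleteSpace K]
    {f : S → H} (hf : IsFrame f) (T : H ≃L[ℂ] K) : IsFrame fun s => T (f s) := by
  obtain ⟨C₁, C₂, h₁, h₁₂, h⟩ := hf
  set A : K →L[ℂ] H := ContinuousLinearMap.adjoint (T : H →L[ℂ] K)
  set B : H →L[ℂ] K := ContinuousLinearMap.adjoint (T.symm : K →L[ℂ] H)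
  have hA : ∀ (y : K) (x : H), ⟪y, T x⟫ = ⟪A y, x⟫ := fun y x =>
    (ContinuousLinearMap.adjoint_inner_left (T : H →L[ℂ] K) x y).symm
  have hBA : ∀ y, B (A y) = y := fun y => by
    refine ext_inner_right ℂ fun z => ?_
    calc ⟪B (A y), z⟫ = ⟪A y, T.symm z⟫ :=
          ContinuousLinearMap.adjoint_inner_left (T.symm : K →L[ℂ] H) z (A y)
      _ = ⟪y, z⟫ := by rw [← hA, T.apply_symm_apply]
  set a : ℝ := ‖A‖ + 1
  set b : ℝ := ‖B‖ + 1
  have ha : 1 ≤ a := le_add_of_nonneg_left (norm_nonneg _)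
  have hb : 1 ≤ b := le_add_of_nonneg_left (norm_nonneg _)
  have hAy : ∀ y, ‖A y‖ ≤ a * ‖y‖ := fun y =>
    A.le_of_opNorm_le (le_add_of_nonneg_right zero_le_one) y
  have hyA : ∀ y, ‖y‖ ≤ b * ‖A y‖ := fun y => by
    simpa only [hBA] using B.le_of_opNorm_le (le_add_of_nonneg_right zero_le_one) (A y)
  have hC₂ : 0 < C₂ := h₁.trans_le h₁₂
  refine ⟨C₁ / b ^ 2, C₂ * a ^ 2, by positivity, ?_, fun y => ?_⟩
  · calc C₁ / b ^ 2 ≤ C₁ := div_le_self h₁.le (one_le_pow₀ hb)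
      _ ≤ C₂ := h₁₂
      _ ≤ C₂ * a ^ 2 := le_mul_of_one_le_right hC₂.le (one_le_pow₀ ha)
  · simp only [hA]
    constructor
    · refine le_trans ?_ (h (A y)).1
      rw [div_mul_eq_mul_div, div_le_iff₀ (by positivity)]
      calc C₁ * ‖y‖ ^ 2 ≤ C₁ * (b * ‖A y‖) ^ 2 := by gcongr; exact hyA y
        _ = C₁ * ‖A y‖ ^ 2 * b ^ 2 := by ring
    · refine (h (A y)).2.trans ?_
      calc C₂ * ‖A y‖ ^ 2 ≤ C₂ * (a * ‖y‖) ^ 2 := by gcongr; exact hAy y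
        _ = C₂ * a ^ 2 * ‖y‖ ^ 2 := by ring

/-- Two frame representations `π` on `H` and `σ` on `K` of a countable
monoid `S` are equivalent iff there exist frame vectors `ξ ∈ H` for `π` and `η ∈ K` for `σ`
such that the frames `(π(s)ξ)` and `(σ(s)η)` are equivalent. -/
theorem statement15 {S H K : Type*} [Monoid S] [Countable S]
    [NormedAddCommGroup H] [InnerProductSpace ℂ H] [CompleteSpace H]
    [TopologicalSpace.SeparableSpace H]
    [NormedAddCommGroup K] [InnerProductSpace ℂ K] [CompleteSpace K]
    [TopologicalSpace.SeparableSpace K]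
    (π : S → (H →L[ℂ] H)) (hπ : IsRepn π) (σ : S → (K →L[ℂ] K)) (hσ : IsRepn σ)
    (hπfr : ∃ ξ : H, IsFrame fun s => π s ξ) (hσfr : ∃ η : K, IsFrame fun s => σ s η) :
    (∃ T : H ≃L[ℂ] K, ∀ (s : S) (x : H), σ s (T x) = T (π s x)) ↔
      (∃ (ξ : H) (η : K) (T : H ≃L[ℂ] K),
        (IsFrame fun s => π s ξ) ∧ (IsFrame fun s => σ s η) ∧
        ∀ s : S, T (π s ξ) = σ s η) := by
  constructor
  · rintro ⟨T, hT⟩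
    obtain ⟨ξ, hξ⟩ := hπfr
    refine ⟨ξ, T ξ, T, hξ, ?_, fun s => (hT s ξ).symm⟩
    simpa only [hT] using hξ.map_equiv T
  · rintro ⟨ξ, η, T, hξ, -, hT⟩
    refine ⟨T, fun s x => ?_⟩
    have heq : (σ s).comp (T : H →L[ℂ] K) = (T : H →L[ℂ] K).comp (π s) := by
      refine ContinuousLinearMap.ext_on hξ.dense_span ?_
      rintro _ ⟨t, rfl⟩
      calc σ s (T (π t ξ)) = (σ s * σ t) η := by rw [hT]; rfl
        _ = T (π (s * t) ξ) := by rw [hT, hσ.2]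
        _ = T (π s (π t ξ)) := by rw [hπ.2]; rfl
    exact DFunLike.congr_fun heq x
end
end
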